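/- arXiv:2110.02901 — 2 statements merged into one kernel-verified Lean document; each statement's English description precedes it below -/
import Mathlib

section
/- If J_μ satisfies the linear Bellman equation J_μ(i) = g(i,μ(i)) + α Σ_j p_{ij}(μ(i)) J_μ(j) for all i, then J_μ is the unique fixed point of B_{μ,m}, and for any initial J the iterates B_{μ,m}^k J converge to J_μ as k → ∞. -/
open Finset Filter

/-- The randomized mini-batch Bellman operator `B_m`. States are `Fin n`
(0-indexed version of `{1,…,n}`); the set `M_m(i)` of already-updated states
consists of the `j` with `(j : ℕ) < m * (i / m)` (the 0-indexed version of
`{1,…,m⌊(i-1)/m⌋}`). The operator is defined recursively in `i`. -/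
noncomputable def Bm (n m : ℕ) (U : Fin n → Finset ℕ) (hU : ∀ i, (U i).Nonempty)
    (p : Fin n → ℕ → Fin n → ℝ) (g : Fin n → ℕ → ℝ) (α : ℝ)
    (J : Fin n → ℝ) (i : Fin n) : ℝ :=
  (U i).inf' (hU i) fun u =>
    g i u
      + α * ∑ j : Fin n, (if (j : ℕ) < m * ((i : ℕ) / m) then 0 else p i u j * J j)
      + α * ∑ j : {j : Fin n // (j : ℕ) < m * ((i : ℕ) / m)},
          p i u j.1 * Bm n m U hU p g α J j.1
termination_by (i : ℕ)
decreasing_by exact lt_of_lt_of_le j.2 (Nat.mul_div_le _ _)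

/-- The standard Bellman operator `T`. -/
noncomputable def Bell (n : ℕ) (U : Fin n → Finset ℕ) (hU : ∀ i, (U i).Nonempty)
    (p : Fin n → ℕ → Fin n → ℝ) (g : Fin n → ℕ → ℝ) (α : ℝ)
    (J : Fin n → ℝ) (i : Fin n) : ℝ :=
  (U i).inf' (hU i) fun u => g i u + α * ∑ j : Fin n, p i u j * J j

/-- The policy mini-batch operator `B_{μ,m}` for a stationary policy `μ`. -/
noncomputable def Bmu (n m : ℕ) (μ : Fin n → ℕ)
    (p : Fin n → ℕ → Fin n → ℝ) (g : Fin n → ℕ → ℝ) (α : ℝ)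
    (J : Fin n → ℝ) (i : Fin n) : ℝ :=
  g i (μ i)
    + α * ∑ j : Fin n, (if (j : ℕ) < m * ((i : ℕ) / m) then 0 else p i (μ i) j * J j)
    + α * ∑ j : {j : Fin n // (j : ℕ) < m * ((i : ℕ) / m)},
        p i (μ i) j.1 * Bmu n m μ p g α J j.1
termination_by (i : ℕ)
decreasing_by exact lt_of_lt_of_le j.2 (Nat.mul_div_le _ _)

/-- `Bmu` averages the updated values on the already-updated states and `J` elsewhere. -/
theorem Bmu_eq_sum_ite (n m : ℕ) (μ : Fin n → ℕ) (p : Fin n → ℕ → Fin n → ℝ)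
    (g : Fin n → ℕ → ℝ) (α : ℝ) (J : Fin n → ℝ) (i : Fin n) :
    Bmu n m μ p g α J i = g i (μ i) + α * ∑ j : Fin n, p i (μ i) j *
      (if (j : ℕ) < m * ((i : ℕ) / m) then Bmu n m μ p g α J j else J j) := by
  have hsub : ∑ j : {j : Fin n // (j : ℕ) < m * ((i : ℕ) / m)},
      p i (μ i) j.1 * Bmu n m μ p g α J j.1 =
      ∑ j : Fin n, if (j : ℕ) < m * ((i : ℕ) / m) then
        p i (μ i) j * Bmu n m μ p g α J j else 0 := by
    rw [← Finset.sum_filter]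
    exact (Finset.sum_subtype _ (by simp) fun j => p i (μ i) j * Bmu n m μ p g α J j).symm
  rw [Bmu, hsub, add_assoc, ← mul_add, ← Finset.sum_add_distrib]
  congr 2
  refine Finset.sum_congr rfl fun j _ => ?_
  split_ifs <;> simp

/-- A solution of the linear Bellman equation is a fixed point of `Bmu`. -/
theorem Bmu_eq_of_bellman (n m : ℕ) (μ : Fin n → ℕ) (p : Fin n → ℕ → Fin n → ℝ)
    (g : Fin n → ℕ → ℝ) (α : ℝ) (J : Fin n → ℝ)
    (hJ : ∀ i, J i = g i (μ i) + α * ∑ j : Fin n, p i (μ i) j * J j) (i : Fin n) :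
    Bmu n m μ p g α J i = J i := by
  induction i using WellFoundedLT.induction with
  | ind i ih =>
    rw [Bmu_eq_sum_ite, hJ i]
    congr 2
    refine Finset.sum_congr rfl fun j _ => ?_
    split_ifs with h
    · rw [ih j (Fin.lt_def.2 (h.trans_le (Nat.mul_div_le _ _)))]
    · rfl

/-- `Bmu` shrinks any uniform bound on the difference of its arguments by the factor `α`. -/
theorem abs_Bmu_sub_le (n m : ℕ) (μ : Fin n → ℕ) (p : Fin n → ℕ → Fin n → ℝ)
    (hp : ∀ i u j, 0 ≤ p i u j) (hpsum : ∀ i u, ∑ j : Fin n, p i u j = 1)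
    (g : Fin n → ℕ → ℝ) (α : ℝ) (hα0 : 0 ≤ α) (hα1 : α ≤ 1) (J J' : Fin n → ℝ) (C : ℝ)
    (hC : ∀ j, |J j - J' j| ≤ C) (i : Fin n) :
    |Bmu n m μ p g α J i - Bmu n m μ p g α J' i| ≤ α * C := by
  induction i using WellFoundedLT.induction with
  | ind i ih =>
    have hC0 : 0 ≤ C := (abs_nonneg _).trans (hC i)
    rw [Bmu_eq_sum_ite n m μ p g α J, Bmu_eq_sum_ite n m μ p g α J', add_sub_add_left_eq_sub,
      ← mul_sub, ← Finset.sum_sub_distrib, abs_mul, abs_of_nonneg hα0]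
    refine mul_le_mul_of_nonneg_left ?_ hα0
    calc _ ≤ ∑ j : Fin n, p i (μ i) j * C := by
          refine (Finset.abs_sum_le_sum_abs _ _).trans (Finset.sum_le_sum fun j _ => ?_)
          rw [← mul_sub, abs_mul, abs_of_nonneg (hp _ _ _)]
          refine mul_le_mul_of_nonneg_left ?_ (hp _ _ _)
          split_ifs with h
          · exact (ih j (Fin.lt_def.2 (h.trans_le (Nat.mul_div_le _ _)))).trans
              (mul_le_of_le_one_left hC0 hα1)
          · exact hC j
      _ = C := by rw [← Finset.sum_mul, hpsum, one_mul]

/-- `Bmu` is a contraction with modulus `α` in the sup norm. -/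
theorem contractingWith_Bmu (n m : ℕ) (μ : Fin n → ℕ) (p : Fin n → ℕ → Fin n → ℝ)
    (hp : ∀ i u j, 0 ≤ p i u j) (hpsum : ∀ i u, ∑ j : Fin n, p i u j = 1)
    (g : Fin n → ℕ → ℝ) (α : ℝ) (hα0 : 0 ≤ α) (hα1 : α < 1) :
    ContractingWith ⟨α, hα0⟩ (Bmu n m μ p g α) := by
  refine ⟨hα1, LipschitzWith.of_dist_le_mul fun J J' => ?_⟩
  refine (dist_pi_le_iff (mul_nonneg hα0 dist_nonneg)).2 fun i => ?_
  exact abs_Bmu_sub_le n m μ p hp hpsum g α hα0 hα1.le J J' _ (fun j => dist_le_pi_dist J J' j) i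

/-- `J_μ` is the unique fixed point of `B_{μ,m}` and the iterates converge to it. -/
theorem Bmu_fixed_point_unique_and_tendsto (n m : ℕ) (hm1 : 1 ≤ m) (hmn : m ≤ n)
    (U : Fin n → Finset ℕ) (hU : ∀ i, (U i).Nonempty)
    (μ : Fin n → ℕ) (hμ : ∀ i, μ i ∈ U i)
    (p : Fin n → ℕ → Fin n → ℝ) (hp : ∀ i u j, 0 ≤ p i u j)
    (hpsum : ∀ i u, ∑ j : Fin n, p i u j = 1)
    (g : Fin n → ℕ → ℝ) (α : ℝ) (hα0 : 0 < α) (hα1 : α < 1)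
    (Jmu : Fin n → ℝ)
    (hfix : ∀ i, Jmu i = g i (μ i) + α * ∑ j : Fin n, p i (μ i) j * Jmu j) :
    (∀ i, Bmu n m μ p g α Jmu i = Jmu i) ∧
    (∀ J' : Fin n → ℝ, (∀ i, Bmu n m μ p g α J' i = J' i) → J' = Jmu) ∧
    (∀ J : Fin n → ℝ, ∀ i,
      Tendsto (fun k => (Bmu n m μ p g α)^[k] J i) atTop (nhds (Jmu i))) := by
  have hcontr := contractingWith_Bmu n m μ p hp hpsum g α hα0.le hα1
  have hJmu := Bmu_eq_of_bellman n m μ p g α Jmu hfix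
  have hFix : Function.IsFixedPt (Bmu n m μ p g α) Jmu := funext hJmu
  refine ⟨hJmu, fun J' hJ' => hcontr.fixedPoint_unique' (funext hJ') hFix, fun J i => ?_⟩
  have hlim := hcontr.tendsto_iterate_fixedPoint J
  rw [← hcontr.fixedPoint_unique hFix] at hlim
  exact tendsto_pi_nhds.1 hlim i
end

section
/- If J : S → ℝ satisfies J ≤ TJ pointwise (where T is the standard Bellman operator), then J ≤ B_m J pointwise for every batch-size 1 ≤ m ≤ n, i.e., the mini-batch update is also monotone improving from such J. -/
open Finset Filter

/-- If `J ≤ TJ` pointwise then also `J ≤ B_m J` pointwise. -/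
theorem le_Bm_of_le_Bell (n m : ℕ) (hm1 : 1 ≤ m) (hmn : m ≤ n)
    (U : Fin n → Finset ℕ) (hU : ∀ i, (U i).Nonempty)
    (p : Fin n → ℕ → Fin n → ℝ) (hp : ∀ i u j, 0 ≤ p i u j)
    (hpsum : ∀ i u, ∑ j : Fin n, p i u j = 1)
    (g : Fin n → ℕ → ℝ) (α : ℝ) (hα0 : 0 < α) (hα1 : α < 1)
    (J : Fin n → ℝ) (hJ : ∀ i, J i ≤ Bell n U hU p g α J i) :
    ∀ i, J i ≤ Bm n m U hU p g α J i := by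
  intro i
  induction i using WellFoundedLT.induction with
  | ind i ih =>
  rw [Bm]
  refine Finset.le_inf' _ _ fun u hu => ?_
  have bellman_le : J i ≤ g i u + α * ∑ j : Fin n, p i u j * J j :=
    (hJ i).trans (Finset.inf'_le _ hu)
  have updated_le :
      ∑ j : {j : Fin n // (j : ℕ) < m * ((i : ℕ) / m)}, p i u j.1 * J j.1 ≤
        ∑ j : {j : Fin n // (j : ℕ) < m * ((i : ℕ) / m)},
          p i u j.1 * Bm n m U hU p g α J j.1 :=
    Finset.sum_le_sum fun j _ => mul_le_mul_of_nonneg_left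
      (ih j.1 (Fin.lt_def.mpr (j.2.trans_le (Nat.mul_div_le _ _)))) (hp i u j.1)
  have sum_split : ∑ j : Fin n, p i u j * J j =
      ∑ j : Fin n, (if (j : ℕ) < m * ((i : ℕ) / m) then 0 else p i u j * J j) +
        ∑ j : {j : Fin n // (j : ℕ) < m * ((i : ℕ) / m)}, p i u j.1 * J j.1 := by
    rw [← Finset.sum_subtype (Finset.univ.filter fun j : Fin n => (j : ℕ) < m * ((i : ℕ) / m))
      (by simp) (fun j => p i u j * J j), Finset.sum_filter, ← Finset.sum_add_distrib]
    exact Finset.sum_congr rfl fun j _ => by split_ifs <;> simp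
  rw [sum_split, mul_add, ← add_assoc] at bellman_le
  exact bellman_le.trans (by gcongr)
end
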